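/- Let F = F_q be a finite field, d ≥ 1, and M a nonzero M_d-matrix over F_q. Then MaxR(M) > (1 − 1/q)^d · CR(M) (strict inequality). -/

import Mathlib

open MvPolynomial

section Defs

variable {F : Type*} [Field F]

/-- A polynomial in the block variables `x_{i,j}` (`i ∈ Fin d`, `j ∈ Fin n`) is
multilinear exactly in the blocks of `S`: every monomial has degree 1 in each block
`i ∈ S` and degree 0 in each block `i ∉ S`. -/
def IsMultilinearOn {d n : ℕ} (S : Finset (Fin d))
    (f : MvPolynomial (Fin d × Fin n) F) : Prop :=
  ∀ m ∈ f.support, ∀ i : Fin d,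
    (∑ j : Fin n, m (i, j)) = if i ∈ S then 1 else 0

/-- A multilinear form: degree 1 in every block of variables. -/
def IsMultilinear {d n : ℕ} (f : MvPolynomial (Fin d × Fin n) F) : Prop :=
  IsMultilinearOn Finset.univ f

/-- Commutative rank: the rank of the matrix over the field of fractions of the
polynomial ring. -/
noncomputable def CR {σ : Type*} {α β : Type*} [Fintype β]
    (M : Matrix α β (MvPolynomial σ F)) : ℕ :=
  (M.map (algebraMap (MvPolynomial σ F) (FractionRing (MvPolynomial σ F)))).rank

/-- `M` is the sum of `r` outer products `u ⊗ v`, where `u` has entries multilinear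
in the blocks of some `S ⊆ [d]` and `v` has entries multilinear in the complementary
blocks. -/
def HasPRDecomp {d n a b : ℕ}
    (M : Matrix (Fin a) (Fin b) (MvPolynomial (Fin d × Fin n) F)) (r : ℕ) : Prop :=
  ∃ (S : Fin r → Finset (Fin d))
    (u : Fin r → Fin a → MvPolynomial (Fin d × Fin n) F)
    (v : Fin r → Fin b → MvPolynomial (Fin d × Fin n) F),
    (∀ t i, IsMultilinearOn (S t) (u t i)) ∧
    (∀ t j, IsMultilinearOn (S t)ᶜ (v t j)) ∧
    M = ∑ t, Matrix.of fun i j => u t i * v t j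

/-- Partition rank of a matrix of multilinear forms. -/
noncomputable def PR {d n a b : ℕ}
    (M : Matrix (Fin a) (Fin b) (MvPolynomial (Fin d × Fin n) F)) : ℕ :=
  sInf {r | HasPRDecomp M r}

/-- Evaluation of a matrix of multilinear forms at a point `p ∈ (F^n)^d`. -/
noncomputable def evalMat {d n : ℕ} {α β : Type*}
    (M : Matrix α β (MvPolynomial (Fin d × Fin n) F)) (p : Fin d → Fin n → F) :
    Matrix α β F :=
  M.map (eval fun v => p v.1 v.2)

/-- Max-rank: the largest rank of a scalar evaluation. -/
noncomputable def MaxR {d n : ℕ} {α β : Type*} [Fintype β]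
    (M : Matrix α β (MvPolynomial (Fin d × Fin n) F)) : ℕ :=
  ⨆ p : Fin d → Fin n → F, (evalMat M p).rank

/-- Partial evaluation: substitute `x_i := p_i` for `i ∈ S`, leaving the other
blocks of variables untouched. -/
noncomputable def pevalMat {d n : ℕ} {α β : Type*}
    (M : Matrix α β (MvPolynomial (Fin d × Fin n) F)) (S : Finset (Fin d))
    (p : Fin d → Fin n → F) :
    Matrix α β (MvPolynomial (Fin d × Fin n) F) :=
  M.map (aeval fun v : Fin d × Fin n => if v.1 ∈ S then C (p v.1 v.2) else X v)

end Defs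

section D1

variable {F : Type*} [Field F]

/-- Partition-rank decomposition for matrices of linear forms: a sum of `r` outer
products, each either (scalars) ⊗ (linear forms) or (linear forms) ⊗ (scalars). -/
def HasPR1Decomp {n a b : ℕ}
    (M : Matrix (Fin a) (Fin b) (MvPolynomial (Fin n) F)) (r : ℕ) : Prop :=
  ∃ (c : Fin r → Bool)
    (u : Fin r → Fin a → MvPolynomial (Fin n) F)
    (v : Fin r → Fin b → MvPolynomial (Fin n) F),
    (∀ t i, (u t i).IsHomogeneous (if c t then 0 else 1)) ∧
    (∀ t j, (v t j).IsHomogeneous (if c t then 1 else 0)) ∧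
    M = ∑ t, Matrix.of fun i j => u t i * v t j

/-- Partition rank of a matrix of linear forms. -/
noncomputable def PR1 {n a b : ℕ}
    (M : Matrix (Fin a) (Fin b) (MvPolynomial (Fin n) F)) : ℕ :=
  sInf {r | HasPR1Decomp M r}

/-- Max-rank of a matrix of linear forms. -/
noncomputable def MaxR1 {n a b : ℕ}
    (M : Matrix (Fin a) (Fin b) (MvPolynomial (Fin n) F)) : ℕ :=
  ⨆ p : Fin n → F, (M.map (eval p)).rank

end D1

section Tensor3

variable {F : Type*} [Field F]

/-- Substitute the first two blocks of variables of a trilinear form at `x` and `y`,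
leaving a polynomial in the third block. -/
noncomputable def sub01 {n : ℕ} (T : MvPolynomial (Fin 3 × Fin n) F)
    (x y : Fin n → F) : MvPolynomial (Fin 3 × Fin n) F :=
  aeval (fun v : Fin 3 × Fin n =>
    if v.1 = 0 then C (x v.2) else if v.1 = 1 then C (y v.2) else X v) T

open Classical in
/-- The bias of a 3-tensor: the probability over `(x, y)` that `T(x, y, -)` is the
zero linear form. -/
noncomputable def bias {n : ℕ} [Fintype F] (T : MvPolynomial (Fin 3 × Fin n) F) : ℝ :=
  ((Finset.univ.filter fun p : (Fin n → F) × (Fin n → F) =>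
      sub01 T p.1 p.2 = 0).card : ℝ) /
    ((Fintype.card ((Fin n → F) × (Fin n → F))) : ℝ)

/-- The analytic rank of a 3-tensor. -/
noncomputable def AR {n : ℕ} [Fintype F] (T : MvPolynomial (Fin 3 × Fin n) F) : ℝ :=
  - Real.logb (Fintype.card F) (bias T)

/-- A slice-rank decomposition: `T = ∑ f_t g_t` with `f_t` a linear form in one
block and `g_t` a bilinear form in the other two blocks. -/
def HasSRDecomp {n : ℕ} (T : MvPolynomial (Fin 3 × Fin n) F) (r : ℕ) : Prop :=
  ∃ (c : Fin r → Fin 3) (f g : Fin r → MvPolynomial (Fin 3 × Fin n) F),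
    (∀ t, IsMultilinearOn {c t} (f t)) ∧
    (∀ t, IsMultilinearOn ({c t} : Finset (Fin 3))ᶜ (g t)) ∧
    T = ∑ t, f t * g t

/-- Slice rank of a 3-tensor. -/
noncomputable def SR {n : ℕ} (T : MvPolynomial (Fin 3 × Fin n) F) : ℕ :=
  sInf {r | HasSRDecomp T r}

/-- The matrix `mat T` of a 3-tensor, evaluated at `x` in its first block:
the `(j,k)` entry is `T(x, e_j, e_k)`. -/
noncomputable def matT {n : ℕ} (T : MvPolynomial (Fin 3 × Fin n) F)
    (x : Fin n → F) : Matrix (Fin n) (Fin n) F :=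
  Matrix.of fun j k => eval (fun v : Fin 3 × Fin n =>
    if v.1 = 0 then x v.2
    else if v.1 = 1 then (if v.2 = j then 1 else 0)
    else (if v.2 = k then 1 else 0)) T

end Tensor3

section Mult

variable {F : Type*} [Field F]

/-- `mult(f, p)`: the minimum total degree of a monomial of `f(x + p)`. -/
noncomputable def polyMult {n : ℕ} (f : MvPolynomial (Fin n) F) (p : Fin n → F) : ℕ :=
  sInf {k | ∃ m ∈ (aeval (fun i : Fin n => X i + C (p i)) f :
    MvPolynomial (Fin n) F).support, (∑ i, m i) = k}

end Mult


theorem aux_factor {K : Type*} [Field K] {a b : ℕ} (N : Matrix (Fin a) (Fin b) K) :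
    ∃ (P : Matrix (Fin a) (Fin N.rank) K) (Q : Matrix (Fin N.rank) (Fin b) K), N = P * Q := by
  let V := LinearMap.range N.mulVecLin
  let e : V ≃ₗ[K] (Fin N.rank → K) := (Module.finBasisOfFinrankEq K V rfl).equivFun
  refine ⟨LinearMap.toMatrix' (V.subtype ∘ₗ e.symm.toLinearMap),
    LinearMap.toMatrix' (e.toLinearMap ∘ₗ N.mulVecLin.rangeRestrict), ?_⟩
  rw [← LinearMap.toMatrix'_comp]
  apply (Matrix.toLin').injective
  rw [Matrix.toLin'_toMatrix']
  ext x
  simp [V]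

theorem aux_inv {K : Type*} [Field K] {a b : ℕ} (N : Matrix (Fin a) (Fin b) K) :
    ∃ (P : Matrix (Fin N.rank) (Fin a) K) (Q : Matrix (Fin b) (Fin N.rank) K),
      P * N * Q = 1 := by
  let V := LinearMap.range N.mulVecLin
  let e : V ≃ₗ[K] (Fin N.rank → K) := (Module.finBasisOfFinrankEq K V rfl).equivFun
  obtain ⟨s, hs⟩ := LinearMap.exists_rightInverse_of_surjective N.mulVecLin.rangeRestrict
    (LinearMap.range_rangeRestrict _)
  obtain ⟨t, ht⟩ := LinearMap.exists_leftInverse_of_injective V.subtype (Submodule.ker_subtype V)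
  refine ⟨LinearMap.toMatrix' (e.toLinearMap ∘ₗ t),
    LinearMap.toMatrix' (s ∘ₗ e.symm.toLinearMap), ?_⟩
  have hN : N = LinearMap.toMatrix' N.mulVecLin := by simp [← Matrix.toLin'_apply']
  conv_lhs => enter [1,2]; rw [hN]
  rw [← LinearMap.toMatrix'_comp, ← LinearMap.toMatrix'_comp, ← LinearMap.toMatrix'_id]
  congr 1
  apply LinearMap.ext
  intro x
  have h1 : N.mulVecLin (s (e.symm x)) = V.subtype (e.symm x) := by
    have := LinearMap.congr_fun hs (e.symm x)
    have := congrArg V.subtype this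
    simpa using this
  have h2 := LinearMap.congr_fun ht (e.symm x)
  simp only [LinearMap.comp_apply, LinearEquiv.coe_coe, LinearMap.id_apply] at *
  rw [h1, h2]; simp

theorem aux_rank_map {K L : Type*} [Field K] [Field L] (f : K →+* L) {a b : ℕ}
    (N : Matrix (Fin a) (Fin b) K) : (N.map f).rank ≤ N.rank := by
  obtain ⟨P, Q, h⟩ := aux_factor N
  have : N.map f = P.map f * Q.map f := by rw [← Matrix.map_mul, ← h]
  rw [this]
  exact (Matrix.rank_mul_le_left _ _).trans (Matrix.rank_le_width _)

/-- translation -/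
noncomputable def transl {K : Type*} [Field K] {n : ℕ} (p : Fin n → K) :
    MvPolynomial (Fin n) K →ₐ[K] MvPolynomial (Fin n) K := aeval fun i => X i + C (p i)

theorem transl_inj {K : Type*} [Field K] {n : ℕ} (p : Fin n → K) (f : MvPolynomial (Fin n) K)
    (h : transl p f = 0) : f = 0 := by
  have : (transl (-p)).comp (transl p) = AlgHom.id K _ := by
    apply MvPolynomial.algHom_ext
    intro i
    simp [transl]
  have h2 := congrArg (transl (-p)) h
  rw [← AlgHom.comp_apply, this] at h2
  simpa using h2

theorem transl_succ {K : Type*} [Field K] {n : ℕ} (c : K) (p : Fin n → K)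
    (f : MvPolynomial (Fin (n+1)) K) :
    finSuccEquiv K n (transl (Fin.cons c p) f) =
      Polynomial.taylor (C c) ((finSuccEquiv K n f).map (transl p).toRingHom) := by
  have : ((finSuccEquiv K n).toAlgHom.comp (transl (Fin.cons c p))).toRingHom =
      (Polynomial.taylorAlgHom (C c : MvPolynomial (Fin n) K)).toRingHom.comp
        ((Polynomial.mapRingHom (transl p).toRingHom).comp
          (finSuccEquiv K n).toAlgHom.toRingHom) := by
    apply MvPolynomial.ringHom_ext
    · intro r
      simp [transl, finSuccEquiv_apply, Polynomial.taylor_apply]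
    · intro i
      refine Fin.cases ?_ (fun j => ?_) i
      · simp [transl, finSuccEquiv_X_zero, finSuccEquiv_X_succ, Polynomial.taylor_apply]
        simp [finSuccEquiv_apply]
      · simp [transl, finSuccEquiv_X_zero, finSuccEquiv_X_succ, Polynomial.taylor_apply]
        simp [finSuccEquiv_apply]
  exact RingHom.congr_fun this f

theorem taylor_coeffwise {K : Type*} [Field K] {n : ℕ} (c : K) (i : Fin n →₀ ℕ)
    (h : Polynomial (MvPolynomial (Fin n) K)) (g : Polynomial K)
    (hg : ∀ k, g.coeff k = (h.coeff k).coeff i) (j : ℕ) :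
    (Polynomial.taylor c g).coeff j = ((Polynomial.taylor (C c) h).coeff j).coeff i := by
  rw [Polynomial.taylor_coeff, Polynomial.taylor_coeff, Polynomial.eval_eq_sum_range' (n := g.natDegree + h.natDegree + 1),
    Polynomial.eval_eq_sum_range' (n := g.natDegree + h.natDegree + 1), coeff_sum]
  · apply Finset.sum_congr rfl
    intro k _
    rw [Polynomial.hasseDeriv_coeff, Polynomial.hasseDeriv_coeff, hg, ← C_pow, mul_comm _ (C (c ^ k)),
      coeff_C_mul, ← C_eq_coe_nat, coeff_C_mul]
    ring
  · have := Polynomial.natDegree_hasseDeriv_le h j; omega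
  · have := Polynomial.natDegree_hasseDeriv_le g j; omega

theorem exists_min_coeff {K : Type*} [Field K] {n : ℕ} (f : MvPolynomial (Fin n) K) (hf : f ≠ 0) :
    ∃ i : Fin n →₀ ℕ, f.coeff i ≠ 0 ∧ ∀ x, x.degree < i.degree → f.coeff x = 0 := by
  obtain ⟨i, hi, hm⟩ := f.support.exists_min_image (fun x => x.degree)
    (support_nonempty.mpr hf)
  refine ⟨i, by simpa using hi, fun x hx => ?_⟩
  by_contra hc
  have := hm x (by simpa using hc)
  omega

theorem sum_roots_le {F K : Type*} [Field F] [Fintype F] [Field K] (φ : F →+* K)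
    (g : Polynomial K) (hg : g ≠ 0) (w : F → ℕ)
    (h : ∀ c j, j < w c → (Polynomial.taylor (φ c) g).coeff j = 0) :
    ∑ c, w c ≤ g.natDegree := by
  classical
  have h1 : ∀ c, w c ≤ g.roots.count (φ c) := by
    intro c
    rw [Polynomial.count_roots, Polynomial.le_rootMultiplicity_iff hg]
    have h2 : Polynomial.X ^ (w c) ∣ Polynomial.taylor (φ c) g :=
      Polynomial.X_pow_dvd_iff.mpr (h c)
    obtain ⟨u, hu⟩ := h2
    refine ⟨Polynomial.taylor (-φ c) u, ?_⟩
    have := congrArg (Polynomial.taylor (-φ c)) hu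
    rw [Polynomial.taylor_taylor, Polynomial.taylor_mul, Polynomial.taylor_X_pow] at this
    simpa [sub_eq_add_neg] using this
  calc ∑ c, w c ≤ ∑ c, g.roots.count (φ c) := Finset.sum_le_sum fun c _ => h1 c
    _ = ∑ x ∈ Finset.univ.map ⟨φ, φ.injective⟩, g.roots.count x := by simp
    _ ≤ g.roots.card := by
      rw [← Multiset.toFinset_sum_count_eq]
      apply Finset.sum_le_sum_of_ne_zero
      intro x _ hx
      rw [Multiset.mem_toFinset]
      exact Multiset.count_ne_zero.mp hx
    _ ≤ _ := Polynomial.card_roots' g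

theorem sz_mult {F K : Type*} [Field F] [Fintype F] [Field K] (φ : F →+* K) (n : ℕ) :
    ∀ (f : MvPolynomial (Fin n) K), f ≠ 0 → ∀ w : (Fin n → F) → ℕ,
      (∀ p x, x.degree < w p → (transl (fun i => φ (p i)) f).coeff x = 0) →
      Fintype.card F * ∑ p, w p ≤ f.totalDegree * Fintype.card F ^ n := by
  induction n with
  | zero =>
    intro f hf w hw
    have h0 : ∀ p, w p = 0 := by
      intro p
      by_contra hc
      apply hf
      apply transl_inj (fun i => φ (p i))
      ext x
      have hx : x = 0 := Subsingleton.elim _ _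
      rw [hw p x (by rw [hx]; simp; omega)]; simp
    simp [h0]
  | succ n ih =>
    intro f hf w hw
    set h := finSuccEquiv K n f with hh
    have hne : h ≠ 0 := by simpa [hh] using hf
    set e := h.natDegree
    have hlc : h.coeff e ≠ 0 := by simpa [e] using hne
    have hdeg : (h.coeff e).totalDegree + e ≤ f.totalDegree :=
      totalDegree_coeff_finSuccEquiv_add_le f e hlc
    have hex : ∀ p : Fin n → F, ∃ i : Fin n →₀ ℕ, (transl (fun k => φ (p k)) (h.coeff e)).coeff i ≠ 0
        ∧ ∀ x, x.degree < i.degree → (transl (fun k => φ (p k)) (h.coeff e)).coeff x = 0 :=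
      fun p => exists_min_coeff _ (fun hz => hlc (transl_inj _ _ hz))
    choose i hi1 hi2 using hex
    have hIH := ih (h.coeff e) hlc (fun p => (i p).degree) hi2
    have hp : ∀ p : Fin n → F, ∑ c, w (Fin.cons c p) ≤ Fintype.card F * (i p).degree + e := by
      intro p
      set t := transl (fun k => φ (p k)) with ht
      let g : Polynomial K := ∑ k ∈ Finset.range (e+1), Polynomial.monomial k ((t (h.coeff k)).coeff (i p))
      have hg : ∀ k, g.coeff k = (t (h.coeff k)).coeff (i p) := by
        intro k
        simp only [g, Polynomial.finsetSum_coeff, Polynomial.coeff_monomial]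
        rw [Finset.sum_ite_eq']
        split_ifs with hk
        · rfl
        · rw [Polynomial.coeff_eq_zero_of_natDegree_lt (by simp at hk; omega)]; simp
      have hg0 : g ≠ 0 := by
        intro hz
        apply hi1 p
        rw [← hg, hz]; simp
      have hgd : g.natDegree ≤ e := by
        rw [Polynomial.natDegree_le_iff_coeff_eq_zero]
        intro N hN
        rw [hg, Polynomial.coeff_eq_zero_of_natDegree_lt hN]; simp
      have := sum_roots_le φ g hg0 (fun c => w (Fin.cons c p) - (i p).degree) (by
        intro c j hj
        rw [taylor_coeffwise (φ c) (i p) (h.map t.toRingHom) g (by intro k; rw [hg, Polynomial.coeff_map]; rfl), hh, ht,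
          ← transl_succ, finSuccEquiv_coeff_coeff]
        have := hw (Fin.cons c p) ((i p).cons j) (by
          rw [Finsupp.degree_eq_sum, Fin.sum_univ_succ]
          simp only [Finsupp.cons_zero, Finsupp.cons_succ]
          rw [Finsupp.degree_eq_sum] at hj
          omega)
        convert this using 3
        congr 1
        funext k
        refine Fin.cases ?_ (fun l => ?_) k <;> simp)
      calc ∑ c, w (Fin.cons c p) ≤ ∑ c, ((i p).degree + (w (Fin.cons c p) - (i p).degree)) :=
            Finset.sum_le_sum fun c _ => by omega
        _ ≤ _ := by rw [Finset.sum_add_distrib]; simp only [Finset.sum_const, Finset.card_univ, smul_eq_mul]; omega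
    have hs : ∑ p, w p = ∑ p : Fin n → F, ∑ c, w (Fin.cons c p) := by
      rw [← Equiv.sum_comp (Fin.consEquiv fun _ => F), Fintype.sum_prod_type_right]
      rfl
    rw [hs]
    set q := Fintype.card F
    calc q * ∑ p : Fin n → F, ∑ c, w (Fin.cons c p)
        ≤ q * ∑ p : Fin n → F, (q * (i p).degree + e) := by gcongr with p; exact hp p
      _ = q * (q * ∑ p, (i p).degree) + e * q^(n+1) := by
          rw [Finset.sum_add_distrib, ← Finset.mul_sum]
          simp [q]; ring
      _ ≤ q * ((h.coeff e).totalDegree * q^n) + e * q^(n+1) := by gcongr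
      _ = ((h.coeff e).totalDegree + e) * q^(n+1) := by ring
      _ ≤ _ := by gcongr

/-- the generic linear combination of matrices -/
noncomputable def genMat {K : Type*} [Field K] {n r : ℕ} (B : Fin n → Matrix (Fin r) (Fin r) K) :
    Matrix (Fin r) (Fin r) (MvPolynomial (Fin n) K) :=
  Matrix.of fun i k => ∑ j, X j * C (B j i k)

theorem genMat_det_deg {K : Type*} [Field K] {n r : ℕ} (B : Fin n → Matrix (Fin r) (Fin r) K) :
    (genMat B).det.totalDegree ≤ r := by
  rw [Matrix.det_apply]
  refine totalDegree_finsetSum_le fun σ _ => ?_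
  refine (totalDegree_smul_le _ _).trans ?_
  refine (totalDegree_finsetProd _ _).trans ?_
  refine (Finset.sum_le_card_nsmul _ _ 1 fun i _ => ?_).trans (by simp)
  change (∑ j, X j * C (B j (σ i) i) : MvPolynomial (Fin n) K).totalDegree ≤ 1
  refine totalDegree_finsetSum_le fun j _ => ?_
  refine (totalDegree_mul _ _).trans ?_
  simp

theorem det_mem_pow {R : Type*} [CommRing R] (I : Ideal R) {r : ℕ} (A : Matrix (Fin r) (Fin r) R)
    (T : Finset (Fin r)) (h : ∀ i ∈ T, ∀ k, A i k ∈ I) : A.det ∈ I ^ T.card := by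
  rw [← Matrix.det_transpose, Matrix.det_apply]
  refine Ideal.sum_mem _ fun σ _ => ?_
  refine Submodule.smul_of_tower_mem _ _ ?_
  simp only [Matrix.transpose_apply]
  rw [← Finset.prod_mul_prod_compl T]
  refine Ideal.mul_mem_right _ _ ?_
  rw [← Finset.prod_const]
  exact Ideal.prod_mem_prod fun i hi => h i hi _

theorem mult_det {K : Type*} [Field K] {n r : ℕ} (B : Fin n → Matrix (Fin r) (Fin r) K)
    (p : Fin n → K) (x : Fin n →₀ ℕ) (hx : x.degree < r - (∑ j, p j • B j).rank) :
    (transl p (genMat B).det).coeff x = 0 := by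
  classical
  set N := ∑ j, p j • B j with hN
  obtain ⟨L, L', D, hM0⟩ := Matrix.Pivot.exists_list_transvec_mul_mul_list_transvec_eq_diagonal N
  set V := (L.map Matrix.TransvectionStruct.toMatrix).prod
  set U := (L'.map Matrix.TransvectionStruct.toMatrix).prod
  have hV : V.det = 1 := Matrix.TransvectionStruct.det_toMatrix_prod L
  have hU : U.det = 1 := Matrix.TransvectionStruct.det_toMatrix_prod L'
  have hrank : N.rank = Fintype.card {i // D i ≠ 0} := by
    rw [← Matrix.rank_diagonal, ← hM0, Matrix.rank_mul_eq_left_of_isUnit_det _ _ (by simp [hU]),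
      Matrix.rank_mul_eq_right_of_isUnit_det _ _ (by simp [hV])]
  set T : Finset (Fin r) := Finset.univ.filter fun i => D i = 0 with hT
  have hTc : T.card = r - N.rank := by
    rw [hrank, Fintype.card_subtype]
    have := Finset.card_filter_add_card_filter_not (s := (Finset.univ : Finset (Fin r))) (fun i => D i = 0)
    simp only [Finset.card_univ, Fintype.card_fin] at this
    rw [hT]; simp only [ne_eq]; omega
  rw [← hTc] at hx
  refine (mem_pow_idealOfVars_iff' T.card _).mp ?_ x hx
  have h1 : transl p (genMat B).det = (N.map C + genMat B).det := by
    rw [AlgHom.map_det]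
    congr 1
    ext i k : 2
    simp [genMat, transl, hN, Matrix.sum_apply, add_mul, Finset.sum_add_distrib, add_comm]
  have h2 : (N.map C + genMat B).det = (V.map C * (N.map C + genMat B) * U.map C).det := by
    have e1 : (V.map (C : K →+* MvPolynomial (Fin n) K)).det = 1 := by
      have := RingHom.map_det (C : K →+* MvPolynomial (Fin n) K) V
      rw [hV, map_one] at this; exact this.symm
    have e2 : (U.map (C : K →+* MvPolynomial (Fin n) K)).det = 1 := by
      have := RingHom.map_det (C : K →+* MvPolynomial (Fin n) K) U
      rw [hU, map_one] at this; exact this.symm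
    rw [Matrix.det_mul, Matrix.det_mul, e1, e2]; simp
  rw [h1, h2, mul_add, add_mul, ← Matrix.map_mul, ← Matrix.map_mul, hM0]
  apply det_mem_pow
  intro i hi k
  have hD : D i = 0 := by simpa [hT] using hi
  have hG : ∀ a b, genMat B a b ∈ idealOfVars (Fin n) K := by
    intro a b
    change (∑ j, X j * C (B j a b) : MvPolynomial (Fin n) K) ∈ _
    exact Ideal.sum_mem _ fun j _ => Ideal.mul_mem_right _ _ (Ideal.subset_span (Set.mem_range_self j))
  rw [Matrix.add_apply]
  refine Ideal.add_mem _ ?_ ?_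
  · simp [Matrix.diagonal_apply, hD]
  · rw [Matrix.mul_apply]
    refine Ideal.sum_mem _ fun l _ => Ideal.mul_mem_right _ _ ?_
    rw [Matrix.mul_apply]
    exact Ideal.sum_mem _ fun l' _ => Ideal.mul_mem_left _ _ (hG _ _)

theorem core {F K : Type*} [Field F] [Fintype F] [Field K] (φ : F →+* K) {n a b : ℕ}
    (A : Fin n → Matrix (Fin a) (Fin b) K) (ξ : Fin n → K) (hpos : 0 < (∑ j, ξ j • A j).rank) :
    ∃ p : Fin n → F, (1 - 1 / (Fintype.card F : ℝ)) * ((∑ j, ξ j • A j).rank : ℝ) <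
      ((∑ j, φ (p j) • A j).rank : ℝ) := by
  obtain ⟨P, Q, hPQ⟩ := aux_inv (∑ j, ξ j • A j)
  generalize hr : (∑ j, ξ j • A j).rank = r at *
  let B : Fin n → Matrix (Fin r) (Fin r) K := fun j => P * A j * Q
  have hB : ∀ v : Fin n → K, ∑ j, v j • B j = P * (∑ j, v j • A j) * Q := by
    intro v
    simp [B, Matrix.mul_sum, Matrix.sum_mul]
  have hf : (genMat B).det ≠ 0 := by
    intro hz
    have h1 : eval ξ (genMat B).det = (∑ j, ξ j • B j).det := by
      rw [RingHom.map_det]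
      congr 1
      ext i k
      simp [genMat, Matrix.sum_apply]
    rw [hz, hB, hPQ] at h1
    simp at h1
  have hsz := sz_mult φ n _ hf (fun p => r - (∑ j, φ (p j) • B j).rank)
    (fun p x hx => mult_det B (fun j => φ (p j)) x hx)
  have hsz2 := hsz.trans (Nat.mul_le_mul_right _ (genMat_det_deg B))
  set q := Fintype.card F with hq
  have hq2 : 1 < q := Fintype.one_lt_card
  have hqR : (0:ℝ) < q := by exact_mod_cast (by omega : 0 < q)
  have hle : ∀ p : Fin n → F, (∑ j, φ (p j) • B j).rank ≤ (∑ j, φ (p j) • A j).rank := by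
    intro p
    rw [hB (fun j => φ (p j))]
    exact (Matrix.rank_mul_le_left _ _).trans (Matrix.rank_mul_le_right _ _)
  by_contra hcon
  push Not at hcon
  have hall : ∀ p : Fin n → F, r ≤ q * (r - (∑ j, φ (p j) • B j).rank) := by
    intro p
    have h1 := hcon p
    have h2 : ((∑ j, φ (p j) • B j).rank : ℝ) ≤ (1 - 1 / (q:ℝ)) * r :=
      le_trans (by exact_mod_cast hle p) h1
    have h3 : (∑ j, φ (p j) • B j).rank ≤ r := Matrix.rank_le_width _
    have h4 : (r : ℝ) ≤ q * ((r:ℝ) - (∑ j, φ (p j) • B j).rank) := by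
      have : (r:ℝ) = q * ((r:ℝ) - (1 - 1 / (q:ℝ)) * r) := by field_simp; ring
      calc (r:ℝ) = q * ((r:ℝ) - (1 - 1 / (q:ℝ)) * r) := this
        _ ≤ _ := by gcongr
    rw [← Nat.cast_sub h3] at h4
    exact_mod_cast h4
  have hlt : ∑ p : Fin n → F, r < ∑ p : Fin n → F, q * (r - (∑ j, φ (p j) • B j).rank) := by
    refine Finset.sum_lt_sum (fun p _ => hall p) ⟨0, Finset.mem_univ _, ?_⟩
    simp
    nlinarith
  rw [← Finset.mul_sum] at hlt
  simp only [Finset.sum_const, Finset.card_univ, Fintype.card_fun, Fintype.card_fin, smul_eq_mul,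
    ← hq] at hlt
  rw [mul_comm] at hlt
  omega

/-- evaluation of the matrix at a point with coordinates in an extension -/
noncomputable def evK {F K : Type*} [Field F] [Field K] (φ : F →+* K) {d n a b : ℕ}
    (M : Matrix (Fin a) (Fin b) (MvPolynomial (Fin d × Fin n) F)) (v : Fin d → Fin n → K) :
    Matrix (Fin a) (Fin b) K := M.map (eval₂Hom φ fun x => v x.1 x.2)

theorem prod_pow_deg_one {K : Type*} [Field K] {n : ℕ} (m : Fin n → ℕ) (hm : ∑ j, m j = 1)
    (w : Fin n → K) :
    ∏ j, w j ^ m j = ∑ j, w j * ∏ k, (Pi.single j 1 : Fin n → K) k ^ m k := by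
  obtain ⟨j0, hj0⟩ : ∃ j0, m j0 ≠ 0 := by
    by_contra hc; push Not at hc; simp [hc] at hm
  have hm' : m = Pi.single j0 1 := by
    have h := Finset.add_sum_erase Finset.univ m (Finset.mem_univ j0)
    have h0 : ∑ x ∈ Finset.univ.erase j0, m x = 0 := by omega
    rw [Finset.sum_eq_zero_iff] at h0
    funext k
    by_cases hk : k = j0
    · subst hk; simp; omega
    · simp [hk, h0 k (by simp [hk])]
  have hp : ∀ u : Fin n → K, ∏ k, u k ^ m k = u j0 := by
    intro u
    rw [Finset.prod_eq_single j0] <;> simp +contextual [hm']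
  simp only [hp]
  simp [Pi.single_apply]

theorem evK_linear {F K : Type*} [Field F] [Field K] (φ : F →+* K) {d n a b : ℕ}
    (M : Matrix (Fin a) (Fin b) (MvPolynomial (Fin d × Fin n) F))
    (hM : ∀ i j, IsMultilinear (M i j)) (v : Fin d → Fin n → K) (i : Fin d) (w : Fin n → K) :
    evK φ M (Function.update v i w) =
      ∑ j, w j • evK φ M (Function.update v i (Pi.single j 1)) := by
  ext s t
  simp only [evK, Matrix.sum_apply, Matrix.smul_apply, Matrix.map_apply, coe_eval₂Hom, eval₂_eq',
    smul_eq_mul, Finset.mul_sum]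
  rw [Finset.sum_comm]
  refine Finset.sum_congr rfl fun m hm => ?_
  have h1 : ∑ j, m (i, j) = 1 := by simpa using hM s t m hm i
  have hsplit : ∀ u : Fin n → K, ∏ x : Fin d × Fin n, Function.update v i u x.1 x.2 ^ m x =
      (∏ j, u j ^ m (i, j)) * ∏ k ∈ Finset.univ.erase i, ∏ j, v k j ^ m (k, j) := by
    intro u
    rw [Fintype.prod_prod_type, ← Finset.mul_prod_erase _ _ (Finset.mem_univ i)]
    congr 1
    · simp
    · refine Finset.prod_congr rfl fun k hk => ?_
      simp only [Function.update_of_ne (Finset.ne_of_mem_erase hk)]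
  simp only [hsplit]
  rw [prod_pow_deg_one (fun j => m (i, j)) h1 w, Finset.sum_mul, Finset.mul_sum]
  refine Finset.sum_congr rfl fun j _ => ?_
  ring

theorem step {F K : Type*} [Field F] [Fintype F] [Field K] (φ : F →+* K) {d n a b : ℕ}
    (M : Matrix (Fin a) (Fin b) (MvPolynomial (Fin d × Fin n) F))
    (hM : ∀ i j, IsMultilinear (M i j)) (v : Fin d → Fin n → K) (i : Fin d)
    (hpos : 0 < (evK φ M v).rank) :
    ∃ p : Fin n → F, (1 - 1 / (Fintype.card F : ℝ)) * ((evK φ M v).rank : ℝ) <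
      ((evK φ M (Function.update v i fun j => φ (p j))).rank : ℝ) := by
  have h := evK_linear φ M hM v i (v i)
  rw [Function.update_eq_self] at h
  rw [h] at hpos
  obtain ⟨p, hp⟩ := core φ _ (v i) hpos
  refine ⟨p, ?_⟩
  rw [← h] at hp
  rw [evK_linear φ M hM v i fun j => φ (p j)]
  exact hp

theorem blocks {F K : Type*} [Field F] [Fintype F] [Field K] (φ : F →+* K) {d n a b : ℕ}
    (M : Matrix (Fin a) (Fin b) (MvPolynomial (Fin d × Fin n) F))
    (hM : ∀ i j, IsMultilinear (M i j)) (v : Fin d → Fin n → K)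
    (hpos : 0 < (evK φ M v).rank) (S : Finset (Fin d)) :
    ∃ p : Fin d → Fin n → F, ∃ u : Fin d → Fin n → K, (∀ i ∈ S, ∀ j, u i j = φ (p i j)) ∧
      (1 - 1 / (Fintype.card F : ℝ)) ^ S.card * ((evK φ M v).rank : ℝ) ≤ (evK φ M u).rank ∧
      (S.Nonempty → (1 - 1 / (Fintype.card F : ℝ)) ^ S.card * ((evK φ M v).rank : ℝ) <
        (evK φ M u).rank) := by
  have hq2 : (1:ℝ) < Fintype.card F := by exact_mod_cast Fintype.one_lt_card
  have hc : 0 < (1 - 1 / (Fintype.card F : ℝ)) := by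
    rw [sub_pos, div_lt_one (by linarith)]; exact hq2
  induction S using Finset.induction_on with
  | empty => exact ⟨0, v, by simp, by simp, by simp⟩
  | insert i S hi ih =>
    obtain ⟨p, u, hu, hle, -⟩ := ih
    have hposR : (0:ℝ) < (evK φ M v).rank := by exact_mod_cast hpos
    have hup : 0 < (evK φ M u).rank := by
      have : (0:ℝ) < (evK φ M u).rank := lt_of_lt_of_le (by positivity) hle
      exact_mod_cast this
    obtain ⟨p', hp'⟩ := step φ M hM u i hup
    have hlt : (1 - 1 / (Fintype.card F : ℝ)) ^ (insert i S).card * ((evK φ M v).rank : ℝ) <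
        (evK φ M (Function.update u i fun j => φ (p' j))).rank := by
      refine lt_of_le_of_lt ?_ hp'
      rw [Finset.card_insert_of_notMem hi, pow_succ', mul_assoc]
      gcongr
    refine ⟨Function.update p i p', _, ?_, hlt.le, fun _ => hlt⟩
    intro k hk j
    by_cases hki : k = i
    · subst hki; simp
    · simp only [Function.update_of_ne hki]
      exact hu k (by simpa [hki] using hk) j

/-- For `d ≥ 1` and a nonzero matrix of multilinear forms over a
finite field, `MaxR(M) > (1 − 1/q)^d · CR(M)` strictly. -/
theorem statement_19 (F : Type*) [Field F] [Fintype F] (d n a b : ℕ)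
    (hd : 1 ≤ d) (hn : 1 ≤ n)
    (M : Matrix (Fin a) (Fin b) (MvPolynomial (Fin d × Fin n) F))
    (hM : ∀ i j, IsMultilinear (M i j)) (hM0 : M ≠ 0) :
    (1 - 1 / (Fintype.card F : ℝ)) ^ d * (CR M : ℝ) < (MaxR M : ℝ) := by
  let R := MvPolynomial (Fin d × Fin n) F
  let K := FractionRing R
  let φ : F →+* K := (algebraMap R K).comp C
  let v : Fin d → Fin n → K := fun i j => algebraMap R K (X (i, j))
  have hv : evK φ M v = M.map (algebraMap R K) := by
    have : (eval₂Hom φ fun x : Fin d × Fin n => v x.1 x.2) = algebraMap R K := by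
      apply MvPolynomial.ringHom_ext <;> simp [φ, v]
    rw [evK, this]
  have hCR : CR M = (evK φ M v).rank := by rw [hv]; rfl
  have hpos : 0 < (evK φ M v).rank := by
    rw [Nat.pos_iff_ne_zero, hv]
    intro h0
    apply hM0
    obtain ⟨P, Q, hPQ⟩ := aux_factor (M.map (algebraMap R K))
    apply Matrix.ext
    intro i j
    apply IsFractionRing.injective R K
    have h1 := congrFun (congrFun hPQ i) j
    have : IsEmpty (Fin (M.map (algebraMap R K)).rank) := by rw [h0]; infer_instance
    rw [Matrix.mul_apply, Finset.univ_eq_empty, Finset.sum_empty] at h1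
    simpa using h1
  obtain ⟨p, u, hu, -, hlt⟩ := blocks φ M hM v hpos Finset.univ
  have hlt := hlt ⟨⟨0, hd⟩, Finset.mem_univ _⟩
  have hu' : u = fun i j => φ (p i j) := by
    funext i j; exact hu i (Finset.mem_univ _) j
  have hev : evK φ M u = (evalMat M p).map φ := by
    rw [evK, evalMat, Matrix.map_map, hu']
    congr 1
    funext f
    simp only [Function.comp, coe_eval₂Hom]
    rw [← eval₂_id, eval₂_comp_left, RingHom.comp_id]
    rfl
  rw [hCR]
  rw [Finset.card_univ, Fintype.card_fin] at hlt
  refine lt_of_lt_of_le hlt ?_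
  have h1 : (evK φ M u).rank ≤ (evalMat M p).rank := by rw [hev]; exact aux_rank_map φ _
  have h2 : (evalMat M p).rank ≤ MaxR M :=
    le_ciSup (f := fun p => (evalMat M p).rank)
      ⟨b, by rintro _ ⟨p, rfl⟩; exact Matrix.rank_le_width _⟩ p
  exact_mod_cast h1.trans h2
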